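/- arXiv:2303.03138 — 2 statements merged into one kernel-verified Lean document; each statement's English description precedes it below -/
import Mathlib

section
/- Let θ be a root of the irreducible polynomial f(x) = x^7 + 2·x^2 + 4·x + 2 ∈ ℤ[x] and K = ℚ(θ). Then the absolute value of the discriminant of f is |D_f| = 2^6 · 3^2 · 83 · 1069, and the index of ℤ[θ] in the ring of integers ℤ_K of K equals 3. -/
open Polynomial NumberField

/-- The discriminant of a monic integer polynomial `f`, defined as the discriminant of the
power basis of `ℤ[X]/(f)` (junk value `0` if `f` is not monic). -/
noncomputable def polyDisc (f : Polynomial ℤ) : ℤ :=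
  if hf : f.Monic then Algebra.discr ℤ (AdjoinRoot.powerBasis' hf).basis else 0

/-- The index `[ℤ_K : ℤ[θ]]` of the order generated by `θ` in the ring of integers. -/
noncomputable def polyIndex {K : Type*} [Field K] [NumberField K] (θ : 𝓞 K) : ℕ :=
  ((Algebra.adjoin ℤ {θ}).toSubring.toAddSubgroup).index

/-- The determinant of the Hankel matrix of the power sums of the roots of
`X ^ 7 + 2 X ^ 2 + 4 X + 2`. -/
theorem det_hankel_powerSums {R : Type*} [CommRing R] :
    Matrix.det (!![7, 0, 0, 0, 0, -10, -24;
      0, 0, 0, 0, -10, -24, -14;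
      0, 0, 0, -10, -24, -14, 0;
      0, 0, -10, -24, -14, 0, 0;
      0, -10, -24, -14, 0, 0, 20;
      -10, -24, -14, 0, 0, 20, 88;
      -24, -14, 0, 0, 20, 88, 144] : Matrix (Fin 7) (Fin 7) R) =
      -(2 ^ 6 * 3 ^ 2 * 83 * 1069) := by
  simp [Matrix.det_succ_row_zero, Fin.sum_univ_succ, Fin.succAbove]
  ring

theorem discr_eq_of_basis_eq_pow {R A : Type*} [CommRing R] [CommRing A] [Algebra R A]
    (b : Module.Basis (Fin 7) R A) (x : A) (hb : ∀ i, b i = x ^ (i : ℕ))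
    (hx : x ^ 7 + 2 * x ^ 2 + 4 * x + 2 = 0) :
    Algebra.discr R b = -(2 ^ 6 * 3 ^ 2 * 83 * 1069) := by
  have h0 : x ^ 0 = b 0 := by simp [hb]
  have h1 : x ^ 1 = b 1 := by simp [hb]
  have h2 : x ^ 2 = b 2 := by simp [hb]
  have h3 : x ^ 3 = b 3 := by simp [hb]
  have h4 : x ^ 4 = b 4 := by simp [hb]
  have h5 : x ^ 5 = b 5 := by simp [hb]
  have h6 : x ^ 6 = b 6 := by simp [hb]
  have hrec (n : ℕ) : x ^ (n + 7) =
      (-2 : R) • x ^ (n + 2) + (-4 : R) • x ^ (n + 1) + (-2 : R) • x ^ n := by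
    simp only [Algebra.smul_def, map_neg, map_ofNat]
    linear_combination x ^ n * hx
  have h7 : x ^ 7 = _ := hrec 0
  have h8 : x ^ 8 = _ := hrec 1
  have h9 : x ^ 9 = _ := hrec 2
  have h10 : x ^ 10 = _ := hrec 3
  have h11 : x ^ 11 = _ := hrec 4
  have h12 : x ^ 12 = _ := hrec 5
  norm_num only at h7 h8 h9 h10 h11 h12
  have htr (k : ℕ) : Algebra.trace R A (x ^ k) = ∑ i : Fin 7, b.repr (x ^ (k + i)) i := by
    rw [Algebra.trace_eq_matrix_trace b, Matrix.trace]
    simp only [Matrix.diag_apply, Algebra.leftMulMatrix_eq_repr_mul, hb, pow_add]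
  have ht (k : ℕ) : Algebra.trace R A (x ^ (k + 7)) = -2 * Algebra.trace R A (x ^ (k + 2)) +
      -4 * Algebra.trace R A (x ^ (k + 1)) + -2 * Algebra.trace R A (x ^ k) := by
    simp only [hrec, map_add, map_smul, smul_eq_mul]
  have t0 : Algebra.trace R A (x ^ 0) = 7 := by
    rw [htr]
    simp [Fin.sum_univ_succ, h0, h1, h2, h3, h4, h5, h6, -pow_zero, -pow_one]
    norm_num
  have t1 : Algebra.trace R A (x ^ 1) = 0 := by
    rw [htr]
    simp [Fin.sum_univ_succ, h0, h1, h2, h3, h4, h5, h6, h7, -pow_zero, -pow_one]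
  have t2 : Algebra.trace R A (x ^ 2) = 0 := by
    rw [htr]
    simp [Fin.sum_univ_succ, h0, h1, h2, h3, h4, h5, h6, h7, h8, -pow_zero, -pow_one]
  have t3 : Algebra.trace R A (x ^ 3) = 0 := by
    rw [htr]
    simp [Fin.sum_univ_succ, h0, h1, h2, h3, h4, h5, h6, h7, h8, h9, -pow_zero, -pow_one]
  have t4 : Algebra.trace R A (x ^ 4) = 0 := by
    rw [htr]
    simp [Fin.sum_univ_succ, h0, h1, h2, h3, h4, h5, h6, h7, h8, h9, h10, -pow_zero, -pow_one]
  have t5 : Algebra.trace R A (x ^ 5) = -10 := by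
    rw [htr]
    simp [Fin.sum_univ_succ, h0, h1, h2, h3, h4, h5, h6, h7, h8, h9, h10, h11, -pow_zero,
      -pow_one]
    norm_num
  have t6 : Algebra.trace R A (x ^ 6) = -24 := by
    rw [htr]
    simp [Fin.sum_univ_succ, h0, h1, h2, h3, h4, h5, h6, h7, h8, h9, h10, h11, h12, -pow_zero,
      -pow_one]
    norm_num
  have t7 : Algebra.trace R A (x ^ 7) = -14 := by
    rw [ht 0, zero_add, zero_add, t0, t1, t2]; norm_num
  have t8 : Algebra.trace R A (x ^ 8) = 0 := by rw [ht 1, t1, t2, t3]; norm_num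
  have t9 : Algebra.trace R A (x ^ 9) = 0 := by rw [ht 2, t2, t3, t4]; norm_num
  have t10 : Algebra.trace R A (x ^ 10) = 20 := by rw [ht 3, t3, t4, t5]; norm_num
  have t11 : Algebra.trace R A (x ^ 11) = 88 := by rw [ht 4, t4, t5, t6]; norm_num
  have t12 : Algebra.trace R A (x ^ 12) = 144 := by rw [ht 5, t5, t6, t7]; norm_num
  have hM : Algebra.traceMatrix R b = !![7, 0, 0, 0, 0, -10, -24;
      0, 0, 0, 0, -10, -24, -14;
      0, 0, 0, -10, -24, -14, 0;
      0, 0, -10, -24, -14, 0, 0;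
      0, -10, -24, -14, 0, 0, 20;
      -10, -24, -14, 0, 0, 20, 88;
      -24, -14, 0, 0, 20, 88, 144] := by
    ext i j
    rw [Algebra.traceMatrix_apply, Algebra.traceForm_apply, hb, hb, ← pow_add]
    fin_cases i <;> fin_cases j <;> first
      | exact t0 | exact t1 | exact t2 | exact t3 | exact t4 | exact t5 | exact t6
      | exact t7 | exact t8 | exact t9 | exact t10 | exact t11 | exact t12
  rw [Algebra.discr_def, hM]
  exact det_hankel_powerSums

theorem dvd_of_sq_dvd_sq_mul_squarefree {p m n : ℕ} (hp : p.Prime) (hm : Squarefree m)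
    (h : n ^ 2 ∣ p ^ 2 * m) : n ∣ p := by
  by_cases hpn : p ∣ n
  · obtain ⟨k, rfl⟩ := hpn
    rw [mul_pow] at h
    have hk : k * k ∣ m := sq k ▸ Nat.dvd_of_mul_dvd_mul_left (pow_pos hp.pos 2) h
    rw [Nat.isUnit_iff.1 (hm k hk), mul_one]
  · have hcop : (n ^ 2).Coprime (p ^ 2) := (((hp.coprime_iff_not_dvd).2 hpn).symm).pow 2 2
    have hn : n * n ∣ m := sq n ▸ hcop.dvd_of_dvd_mul_left h
    rw [Nat.isUnit_iff.1 (hm n hn)]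
    exact one_dvd p

section NumberField

variable {K : Type*} [Field K] [NumberField K]

theorem minpoly_int_eq_of_irreducible {f : ℤ[X]} (hf : f.Monic) (hirr : Irreducible f) {x : K}
    (hx : aeval x f = 0) : minpoly ℤ x = f := by
  have hint : IsIntegral ℤ x := ⟨f, hf, hx⟩
  apply map_injective (algebraMap ℤ ℚ) (algebraMap ℤ ℚ).injective_int
  rw [← minpoly.isIntegrallyClosed_eq_field_fractions' ℚ hint]
  refine (minpoly.eq_of_irreducible_of_monic
    ((hf.irreducible_iff_irreducible_map_fraction_map).1 hirr) ?_ (hf.map _)).symm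
  rwa [aeval_map_algebraMap]

/-- The square of the index of the order generated by `θ`, times the field discriminant, is the
discriminant of the powers of `θ`. -/
theorem polyIndex_sq_mul_discr {n : ℕ} (θ : 𝓞 K)
    (b : Module.Basis (Fin n) ℤ (Algebra.adjoin ℤ {θ}))
    (bK : Module.Basis (Fin n) ℚ K) (hb : ∀ i, ((b i : 𝓞 K) : K) = bK i) :
    (polyIndex θ : ℚ) ^ 2 * discr K = Algebra.discr ℚ bK := by
  have hn : Fintype.card (Module.Free.ChooseBasisIndex ℤ (𝓞 K)) = n := by
    rw [← Module.finrank_eq_card_chooseBasisIndex, RingOfIntegers.rank,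
      Module.finrank_eq_card_basis bK, Fintype.card_fin]
  let e : Algebra.adjoin ℤ {θ} ≃ₗ[ℤ] (Algebra.adjoin ℤ {θ}).toSubring.toAddSubgroup :=
    { toFun x := ⟨x, x.2⟩
      invFun x := ⟨x, x.2⟩
      map_add' _ _ := rfl
      map_smul' _ _ := Subtype.ext (by simp) }
  let bO := (RingOfIntegers.basis K).reindex (Fintype.equivFinOfCardEq hn)
  have hidx : polyIndex θ = (bO.det fun i => (b i : 𝓞 K)).natAbs :=
    AddSubgroup.index_eq_natAbs_det bO _ (b.map e)
  have hdisc : Algebra.discr ℤ (fun i => (b i : 𝓞 K)) = (polyIndex θ : ℤ) ^ 2 * discr K := by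
    rw [hidx, Int.natCast_natAbs, sq_abs, ← discr_eq_discr K bO, Module.Basis.det_apply,
      ← Algebra.discr_of_matrix_vecMul, bO.toMatrix_map_vecMul]
  have hmap : ((Algebra.discr ℤ fun i => (b i : 𝓞 K) : ℤ) : ℚ) = Algebra.discr ℚ bK := by
    rw [Algebra.discr_def, Algebra.discr_def, ← eq_intCast (Int.castRingHom ℚ),
      RingHom.map_det]
    congr 1
    ext i j
    simp only [RingHom.mapMatrix_apply, Matrix.map_apply, Algebra.traceMatrix_apply,
      Algebra.traceForm_apply, Int.coe_castRingHom, Algebra.coe_trace_int, map_mul, ← hb]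
  rw [← hmap, hdisc]
  push_cast
  rfl

theorem not_dvd_polyIndex_of_isEisensteinAt {p : ℕ} (hp : p.Prime) (θ : 𝓞 K)
    (hgen : Algebra.adjoin ℚ {(θ : K)} = ⊤)
    (hei : (minpoly ℤ (θ : K)).IsEisensteinAt (Ideal.span {(p : ℤ)})) (h0 : polyIndex θ ≠ 0) :
    ¬ p ∣ polyIndex θ := by
  intro hdvd
  have : Fact p.Prime := ⟨hp⟩
  set N : AddSubgroup (𝓞 K) := (Algebra.adjoin ℤ {θ}).toSubring.toAddSubgroup with hN
  have : N.FiniteIndex := ⟨h0⟩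
  obtain ⟨z, hz⟩ := exists_prime_addOrderOf_dvd_card' (G := 𝓞 K ⧸ N) p hdvd
  obtain ⟨w, rfl⟩ := QuotientAddGroup.mk_surjective z
  have hw : w ∉ N := by
    intro h
    rw [(QuotientAddGroup.eq_zero_iff w).2 h, addOrderOf_zero] at hz
    exact hp.one_lt.ne hz
  have hpw : p • w ∈ N := by
    rw [← QuotientAddGroup.eq_zero_iff]
    have := addOrderOf_nsmul_eq_zero (w : 𝓞 K ⧸ N)
    rwa [hz] at this
  have hmem (y : 𝓞 K) : (y : K) ∈ Algebra.adjoin ℤ {(θ : K)} ↔ y ∈ N := by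
    have : Algebra.adjoin ℤ {(θ : K)} = (Algebra.adjoin ℤ {θ}).map (Algebra.algHom ℤ (𝓞 K) K) := by
      rw [AlgHom.map_adjoin_singleton]; rfl
    rw [this, Subalgebra.mem_map]
    constructor
    · rintro ⟨u, hu, huy⟩
      rwa [← RingOfIntegers.coe_injective huy]
    · exact fun h => ⟨y, h, rfl⟩
  let B := PowerBasis.ofAdjoinEqTop (θ.isIntegral_coe.tower_top (A := ℚ)) hgen
  have hB : B.gen = θ := PowerBasis.ofAdjoinEqTop_gen _ _
  rw [← hB] at hei
  refine hw ((hmem w).1 ?_)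
  rw [← hB]
  refine mem_adjoin_of_smul_prime_pow_smul_of_minpoly_isEisensteinAt (K := ℚ) (n := 1)
    (Nat.prime_iff_prime_int.1 hp) (hB ▸ θ.isIntegral_coe) w.isIntegral_coe ?_ hei
  rw [hB]
  convert (hmem _).2 hpw using 1
  simp

theorem exists_isIntegral_three_mul_eq {x : K} (hx : x ^ 7 + 2 * x ^ 2 + 4 * x + 2 = 0) :
    ∃ y : 𝓞 K, 3 * (y : K) = x ^ 6 + x ^ 5 + x ^ 4 + x ^ 3 + x ^ 2 + 3 * x + 7 := by
  set η : K := (x ^ 6 + x ^ 5 + x ^ 4 + x ^ 3 + x ^ 2 + 3 * x + 7) / 3 with hη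
  have hη3 : 3 * η = x ^ 6 + x ^ 5 + x ^ 4 + x ^ 3 + x ^ 2 + 3 * x + 7 := by
    rw [hη]; field_simp
  obtain ⟨y, hy⟩ : ∃ y, y = x - 1 := ⟨_, rfl⟩
  obtain rfl : x = y + 1 := by rw [hy]; ring
  have h (k : ℕ) : y ^ k * η ^ k = (-3) ^ k := by
    rw [← mul_pow]
    congr 1
    linear_combination (y * hη3 + hx) / 3
  have hy0 : y ≠ 0 := by
    rintro rfl
    simpa using h 1
  have hP : η ^ 7 - 5 * η ^ 6 + 23 * η ^ 5 - 105 * η ^ 4 + 315 * η ^ 3 - 567 * η ^ 2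
      + 567 * η - 243 = 0 := by
    apply (mul_eq_zero.1 _).resolve_left (pow_ne_zero 7 hy0)
    linear_combination h 7 - 5 * y * h 6 + 23 * y ^ 2 * h 5 - 105 * y ^ 3 * h 4
      + 315 * y ^ 4 * h 3 - 567 * y ^ 5 * h 2 + 567 * y ^ 6 * h 1 - 243 * hx
  refine ⟨⟨η, X ^ 7 - 5 * X ^ 6 + 23 * X ^ 5 - 105 * X ^ 4 + 315 * X ^ 3 - 567 * X ^ 2
      + 567 * X - 243, by monicity!, ?_⟩, hη3⟩
  simpa [eval₂_sub, eval₂_add, eval₂_mul] using hP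

end NumberField

theorem stmt_14 (f : Polynomial ℤ) (hf : f = X ^ 7 + C 2 * X ^ 2 + C 4 * X + C 2)
    (hirr : Irreducible f)
    (K : Type*) [Field K] [NumberField K] (θ : 𝓞 K)
    (hroot : Polynomial.aeval (θ : K) f = 0)
    (hgen : Algebra.adjoin ℚ {(θ : K)} = ⊤) :
    (polyDisc f).natAbs = 2 ^ 6 * 3 ^ 2 * 83 * 1069 ∧ polyIndex θ = 3 := by
  have hmonic : f.Monic := by rw [hf]; monicity!
  have hdeg : f.natDegree = 7 := by rw [hf]; compute_degree!
  have hmin : minpoly ℤ (θ : K) = f := minpoly_int_eq_of_irreducible hmonic hirr hroot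
  have hminO : minpoly ℤ θ = f := by
    rw [← hmin]; exact (minpoly.algebraMap_eq RingOfIntegers.coe_injective θ).symm
  have hθ : (θ : K) ^ 7 + 2 * (θ : K) ^ 2 + 4 * (θ : K) + 2 = 0 := by
    simpa [hf, -eq_intCast] using hroot
  constructor
  · have hgen7 : AdjoinRoot.root f ^ 7 + 2 * AdjoinRoot.root f ^ 2 + 4 * AdjoinRoot.root f + 2
        = 0 := by
      simpa [hf] using AdjoinRoot.eval₂_root f
    have key := discr_eq_of_basis_eq_pow
      ((AdjoinRoot.powerBasis' hmonic).basis.reindex (finCongr hdeg)) (AdjoinRoot.root f)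
      (fun i => by simp; rfl) hgen7
    rw [Module.Basis.coe_reindex, Algebra.discr_reindex] at key
    rw [polyDisc, dif_pos hmonic, key]
    norm_num
  let BK := PowerBasis.ofAdjoinEqTop (θ.isIntegral_coe.tower_top (A := ℚ)) hgen
  have hBK : BK.gen = θ := PowerBasis.ofAdjoinEqTop_gen _ _
  have hBKdim : BK.dim = 7 := by
    rw [← BK.natDegree_minpoly, hBK,
      minpoly.isIntegrallyClosed_eq_field_fractions' ℚ θ.isIntegral_coe, hmin,
      hmonic.natDegree_map, hdeg]
  let bK := BK.basis.reindex (finCongr hBKdim)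
  have hbK (i : Fin 7) : bK i = (θ : K) ^ (i : ℕ) := by simp [bK, hBK]
  let B := Algebra.adjoin.powerBasis' (RingOfIntegers.isIntegral θ)
  have hBdim : B.dim = 7 := by
    rw [Algebra.adjoin.powerBasis'_dim, hminO, hdeg]
  let b := B.basis.reindex (finCongr hBdim)
  have hb (i : Fin 7) : (b i : 𝓞 K) = θ ^ (i : ℕ) := by
    rw [Module.Basis.reindex_apply, B.basis_eq_pow, Algebra.adjoin.powerBasis'_gen]
    rfl
  have hsq : (polyIndex θ : ℤ) ^ 2 * discr K = -(2 ^ 6 * 3 ^ 2 * 83 * 1069) := by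
    have := polyIndex_sq_mul_discr θ b bK fun i => by rw [hb, hbK]; exact map_pow (algebraMap (𝓞 K) K) _ _
    rw [discr_eq_of_basis_eq_pow bK _ hbK hθ] at this
    exact_mod_cast this
  have h0 : polyIndex θ ≠ 0 := by
    intro h
    rw [h] at hsq
    norm_num at hsq
  have hodd : ¬ 2 ∣ polyIndex θ := by
    refine not_dvd_polyIndex_of_isEisensteinAt Nat.prime_two θ hgen ?_ h0
    rw [hmin]
    refine ⟨?_, fun {n} hn => ?_, ?_⟩
    · rw [hmonic.leadingCoeff, Ideal.mem_span_singleton]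
      norm_num
    · rw [hdeg] at hn
      rw [Ideal.mem_span_singleton, hf]
      interval_cases n <;> simp [coeff_X]
    · rw [Ideal.span_singleton_pow, Ideal.mem_span_singleton, hf]
      simp
  have hne1 : polyIndex θ ≠ 1 := by
    intro h1
    obtain ⟨y, hy⟩ := exists_isIntegral_three_mul_eq hθ
    have hyO : 3 * y = θ ^ 6 + θ ^ 5 + θ ^ 4 + θ ^ 3 + θ ^ 2 + 3 * θ + 7 := by
      apply RingOfIntegers.coe_injective
      simpa [map_ofNat (algebraMap (𝓞 K) K)] using hy
    have hyN : y ∈ Algebra.adjoin ℤ {θ} := by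
      have := AddSubgroup.index_eq_one.1 h1
      exact (this ▸ AddSubgroup.mem_top y :)
    have hy' : (3 : ℤ) • (⟨y, hyN⟩ : Algebra.adjoin ℤ {θ}) =
        b 6 + b 5 + b 4 + b 3 + b 2 + (3 : ℤ) • b 1 + (7 : ℤ) • b 0 := by
      apply Subtype.ext
      simp only [zsmul_eq_mul, AddMemClass.coe_add, MulMemClass.coe_mul, SubringClass.coe_intCast,
        hb]
      simpa using hyO
    have h6 := congrArg (fun v => b.repr v 6) hy'
    simp only [map_add, map_smul, Finsupp.add_apply, Finsupp.smul_apply,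
      Module.Basis.repr_self, smul_eq_mul] at h6
    simp at h6
    omega
  have hdvd : polyIndex θ ^ 2 ∣ 2 ^ 6 * (3 ^ 2 * (83 * 1069)) := by
    rw [← Int.natCast_dvd_natCast]
    push_cast
    exact ⟨-discr K, by linear_combination hsq⟩
  have hcop : (polyIndex θ ^ 2).Coprime (2 ^ 6) :=
    (((Nat.prime_two.coprime_iff_not_dvd).2 hodd).symm).pow 2 6
  have h3 : polyIndex θ ∣ 3 :=
    dvd_of_sq_dvd_sq_mul_squarefree Nat.prime_three
      ((Nat.squarefree_mul (by norm_num)).2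
        ⟨Irreducible.squarefree (show Nat.Prime _ by norm_num),
          Irreducible.squarefree (show Nat.Prime _ by norm_num)⟩)
      (hcop.dvd_of_dvd_mul_left hdvd)
  exact ((Nat.dvd_prime Nat.prime_three).1 h3).resolve_left hne1
end

section
/- Let θ be a root of the irreducible polynomial f(x) = x^7 + 5·x^2 + 10·x + 5 ∈ ℤ[x] and K = ℚ(θ). Then ℤ_K = ℤ[θ], i.e., {1, θ, θ^2, …, θ^6} is an integral basis of K (K is monogenic with power basis generated by θ). -/
open Polynomial NumberField

open Module Matrix in
/-- For a family `v` of algebraic integers indexed like an integral basis, the determinant `d` of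
the change of basis matrix satisfies `disc v = d ^ 2 * disc K`, and `d` multiplies the ring of
integers into the `ℤ`-span of `v`. -/
theorem exists_sq_mul_discr_eq_and_smul_mem_span {K : Type*} [Field K] [NumberField K]
    {ι : Type*} [Fintype ι] [DecidableEq ι] (b : Basis ι ℤ (𝓞 K)) (v : ι → 𝓞 K) :
    ∃ d : ℤ, Algebra.discr ℚ (fun i => (v i : K)) = (d : ℚ) ^ 2 * (discr K : ℚ) ∧
      ∀ z : 𝓞 K, d • z ∈ Submodule.span ℤ (Set.range v) := by
  have hv : (b ᵥ* (b.toMatrix v).map (algebraMap ℤ (𝓞 K))) = v := b.toMatrix_map_vecMul v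
  refine ⟨(b.toMatrix v).det, ?_, fun z => ?_⟩
  · have key := Algebra.discr_of_matrix_vecMul (A := ℚ) (fun i => (b i : K))
      ((b.toMatrix v).map (Int.cast : ℤ → ℚ))
    have h1 : (fun i => (b i : K)) ᵥ* ((b.toMatrix v).map (Int.cast : ℤ → ℚ)).map
        (algebraMap ℚ K) = fun i => (v i : K) := by
      funext j
      conv_rhs => rw [← congrFun hv j]
      simp [Matrix.vecMul, dotProduct]
    have h2 : Algebra.discr ℚ (fun i => (b i : K)) = (discr K : ℚ) := by
      rw [← discr_eq_discr K b]
      have := Algebra.discr_localizationLocalization ℤ (nonZeroDivisors ℤ) (Rₘ := ℚ) K b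
      rw [← eq_intCast (algebraMap ℤ ℚ), ← this]
      congr 1
      funext i
      exact (b.localizationLocalization_apply ℚ (nonZeroDivisors ℤ) K i).symm
    rw [h1, h2] at key
    rw [key]
    congr 2
    exact (Int.cast_det _).symm
  · have hb : ∀ j, (b.toMatrix v).det • b j ∈ Submodule.span ℤ (Set.range v) := by
      intro j
      have h : v ᵥ* ((b.toMatrix v).adjugate).map (algebraMap ℤ (𝓞 K)) =
          (b.toMatrix v).det • (b : ι → 𝓞 K) := by
        conv_lhs => enter [1]; rw [← hv]
        rw [Matrix.vecMul_vecMul, ← Matrix.map_mul, Matrix.mul_adjugate]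
        funext j
        simp only [Matrix.vecMul, dotProduct, Matrix.map_apply, Matrix.smul_apply, Matrix.one_apply]
        simp [mul_comm]
      rw [← Pi.smul_apply, ← h]
      refine Submodule.sum_mem _ fun i _ => ?_
      change v i * algebraMap ℤ (𝓞 K) ((b.toMatrix v).adjugate i j) ∈ _
      rw [mul_comm, ← Algebra.smul_def]
      exact Submodule.smul_mem _ _ (Submodule.subset_span ⟨i, rfl⟩)
    rw [← b.sum_repr z, Finset.smul_sum]
    refine Submodule.sum_mem _ fun i _ => ?_
    rw [smul_comm]
    exact Submodule.smul_mem _ _ (hb i)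

/-- If `d ^ 2` divides `p ^ n * m` with `m` squarefree, then `d` is a power of `p`. -/
theorem exists_eq_prime_pow_of_sq_dvd {p m n d : ℕ} (hp : p.Prime) (hm : Squarefree m)
    (hd0 : d ≠ 0) (hd : d ^ 2 ∣ p ^ n * m) : ∃ k, d = p ^ k := by
  obtain ⟨k, e, he, rfl⟩ := Nat.exists_eq_pow_mul_and_not_dvd hd0 p hp.ne_one
  have hcop : (e ^ 2).Coprime (p ^ n) :=
    Nat.Coprime.pow _ _ ((Nat.Prime.coprime_iff_not_dvd hp).2 he).symm
  have h1 : e ^ 2 ∣ m := hcop.dvd_of_dvd_mul_left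
    ((by rw [mul_pow]; exact Dvd.intro_left _ rfl : e ^ 2 ∣ (p ^ k * e) ^ 2).trans hd)
  have : IsUnit e := hm e (by rwa [← sq])
  exact ⟨k, by rw [Nat.isUnit_iff.1 this, mul_one]⟩

/-- The norm of `x - θ` is the value at `x` of the minimal polynomial of a generator `θ`. -/
theorem PowerBasis.norm_algebraMap_sub_gen {F L : Type*} [Field F] [Field L] [Algebra F L]
    (B : PowerBasis F L) (x : F) :
    Algebra.norm F (algebraMap F L x - B.gen) = (minpoly F B.gen).eval x := by
  rw [← charpoly_leftMulMatrix B, Matrix.eval_charpoly, Algebra.norm_eq_matrix_det B.basis, map_sub,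
    AlgHom.commutes]
  rfl

theorem stmt_15 (f : Polynomial ℤ) (hf : f = X ^ 7 + C 5 * X ^ 2 + C 10 * X + C 5)
    (hirr : Irreducible f)
    (K : Type*) [Field K] [NumberField K] (θ : 𝓞 K)
    (hroot : Polynomial.aeval (θ : K) f = 0)
    (hgen : Algebra.adjoin ℚ {(θ : K)} = ⊤) :
    Algebra.adjoin ℤ {θ} = ⊤ := by
  subst hf
  set f : ℤ[X] := X ^ 7 + C 5 * X ^ 2 + C 10 * X + C 5 with hf
  have hdeg : f.natDegree = 7 := by rw [hf]; compute_degree!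
  have hmonic : f.Monic := by rw [hf]; monicity!
  have hint : IsIntegral ℤ (θ : K) := θ.isIntegral_coe
  have hminZ : minpoly ℤ (θ : K) = f := by
    obtain ⟨g, hg⟩ := minpoly.isIntegrallyClosed_dvd hint hroot
    have hu : IsUnit g := (hirr.isUnit_or_isUnit hg).resolve_left (minpoly.not_isUnit ℤ (θ : K))
    exact eq_of_monic_of_associated (minpoly.monic hint) hmonic ⟨hu.unit, hg.symm⟩
  have hminQ : minpoly ℚ (θ : K) = f.map (algebraMap ℤ ℚ) := by
    rw [minpoly.isIntegrallyClosed_eq_field_fractions' ℚ hint, hminZ]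
  have hintQ : IsIntegral ℚ (θ : K) := hint.tower_top
  let B : PowerBasis ℚ K := PowerBasis.ofAdjoinEqTop hintQ hgen
  have hBgen : B.gen = (θ : K) := PowerBasis.ofAdjoinEqTop_gen hintQ hgen
  have hBdim : B.dim = 7 := by
    rw [← B.natDegree_minpoly, hBgen, hminQ, hmonic.natDegree_map, hdeg]
  have hfin : Module.finrank ℚ K = 7 := by rw [B.finrank, hBdim]
  have hnorm (x : ℚ) : Algebra.norm ℚ (algebraMap ℚ K x - (θ : K)) =
      x ^ 7 + 5 * x ^ 2 + 10 * x + 5 := by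
    rw [← hBgen, PowerBasis.norm_algebraMap_sub_gen, hBgen, hminQ, hf]
    simp
  have hrel : (θ : K) ^ 7 + 5 * (θ : K) ^ 2 + 10 * (θ : K) + 5 = 0 := by
    simpa [hf, map_ofNat] using hroot
  have hderiv : aeval (θ : K) (derivative (minpoly ℚ (θ : K))) =
      7 * (θ : K) ^ 6 + 10 * (θ : K) + 10 := by
    rw [hminQ, hf]
    simp [map_ofNat]
    ring
  have hfactor : (algebraMap ℚ K 0 - (θ : K)) * aeval (θ : K) (derivative (minpoly ℚ (θ : K))) =
      algebraMap ℚ K 25 * ((algebraMap ℚ K (-1) - (θ : K)) * (algebraMap ℚ K (-7 / 5) - (θ : K))) := by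
    rw [hderiv]
    simp
    linear_combination (-7) * hrel
  have hnormderiv : Algebra.norm ℚ (aeval (θ : K) (derivative (minpoly ℚ (θ : K)))) =
      5 ^ 6 * 761043 := by
    have := congrArg (Algebra.norm ℚ) hfactor
    rw [map_mul, map_mul, map_mul, hnorm, hnorm, hnorm, Algebra.norm_algebraMap, hfin] at this
    norm_num at this ⊢
    linarith
  have hdisc : Algebra.discr ℚ B.basis = -(5 ^ 6 * 761043) := by
    rw [Algebra.discr_powerBasis_eq_norm, hBgen, hnormderiv, hfin]
    norm_num
  let e : Module.Free.ChooseBasisIndex ℤ (𝓞 K) ≃ Fin B.dim := Fintype.equivOfCardEq (by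
    rw [← Module.finrank_eq_card_chooseBasisIndex, RingOfIntegers.rank, Fintype.card_fin, B.finrank])
  obtain ⟨d, hd, hspan⟩ := exists_sq_mul_discr_eq_and_smul_mem_span
    ((RingOfIntegers.basis K).reindex e) (fun i => θ ^ (i : ℕ))
  have hpow : (fun i : Fin B.dim => ((θ ^ (i : ℕ) : 𝓞 K) : K)) = B.basis := by
    funext i
    rw [B.basis_eq_pow, hBgen]
    exact map_pow (algebraMap (𝓞 K) K) θ i
  rw [hpow, hdisc] at hd
  have hdZ : -(5 ^ 6 * 761043) = d ^ 2 * discr K := by exact_mod_cast hd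
  have hd0 : d ≠ 0 := by
    rintro rfl
    norm_num at hdZ
  have hsq : d.natAbs ^ 2 ∣ 5 ^ 6 * 761043 := by
    refine ⟨(discr K).natAbs, ?_⟩
    rw [← Int.natAbs_pow, ← Int.natAbs_mul, ← hdZ]
    rfl
  have hsqfree : Squarefree 761043 := by
    rw [show 761043 = 3 * 253681 by norm_num, Nat.squarefree_mul (by norm_num)]
    exact ⟨Nat.prime_three.squarefree, (by norm_num : Nat.Prime 253681).squarefree⟩
  obtain ⟨k, hk⟩ := exists_eq_prime_pow_of_sq_dvd Nat.prime_five
    hsqfree (Int.natAbs_ne_zero.2 hd0) hsq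
  have hdvd : d ∣ 5 ^ k := by
    rw [← Int.natAbs_dvd, hk]
    norm_num
  have hspan_le : Submodule.span ℤ (Set.range fun i : Fin B.dim => θ ^ (i : ℕ)) ≤
      Subalgebra.toSubmodule (Algebra.adjoin ℤ {θ}) := by
    rw [Submodule.span_le]
    rintro _ ⟨i, rfl⟩
    exact Subalgebra.pow_mem _ (Algebra.self_mem_adjoin_singleton ℤ θ) _
  have hmap : (Algebra.adjoin ℤ {θ}).map (Algebra.algHom ℤ (𝓞 K) K) =
      Algebra.adjoin ℤ {(θ : K)} := by
    rw [AlgHom.map_adjoin, Set.image_singleton]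
    rfl
  have hinj : Function.Injective (Algebra.algHom ℤ (𝓞 K) K) := RingOfIntegers.coe_injective
  have heis : f.IsEisensteinAt (Submodule.span ℤ {(5 : ℤ)}) := by
    refine hmonic.isEisensteinAt_of_mem_of_notMem ?_ ?_ ?_
    · exact (Ideal.span_singleton_prime (by norm_num)).2 (by norm_num) |>.ne_top
    · intro n hn
      rw [hdeg] at hn
      change _ ∈ Ideal.span {(5 : ℤ)}
      rw [Ideal.mem_span_singleton, hf]
      interval_cases n <;> simp [coeff_X]
    · change _ ∉ Ideal.span {(5 : ℤ)} ^ 2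
      rw [Ideal.span_singleton_pow, Ideal.mem_span_singleton, hf]
      simp
  refine eq_top_iff.2 fun z _ => ?_
  have hz : (z : K) ∈ Algebra.adjoin ℤ {B.gen} := by
    refine mem_adjoin_of_smul_prime_pow_smul_of_minpoly_isEisensteinAt (p := (5 : ℤ)) (n := k)
      (by norm_num) (hBgen ▸ hint) z.isIntegral_coe ?_ (by rwa [hBgen, hminZ])
    obtain ⟨c, hc⟩ := hdvd
    have : (5 : ℤ) ^ k • z ∈ Algebra.adjoin ℤ {θ} := by
      rw [hc, mul_comm, mul_smul]
      exact Subalgebra.smul_mem _ (hspan_le (hspan z)) _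
    rw [hBgen, ← hmap]
    exact ⟨_, this, map_zsmul (Algebra.algHom ℤ (𝓞 K) K) _ _⟩
  rw [hBgen, ← hmap] at hz
  obtain ⟨y, hy, hyz⟩ := hz
  rwa [← hinj hyz]
end
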